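/- Let M′ = PV^d⟨⋆⟩ ⊕ ⨁_{(i,k): i,k ≥ 0, i+k ≤ d−2} PV^i⟨k⟩, where PV^d⟨⋆⟩ is a copy of PV^d and PV^i⟨k⟩ are copies of PV^i, and let T : M′ → M′ be zero on PV^d⟨⋆⟩ and send μ ∈ PV^i⟨k⟩ to ∂μ ∈ PV^{i−1}⟨k+1⟩ (zero when i = 0). Then T∘T = 0 and the map given by the identity on PV^d⟨⋆⟩ together with the ⟨0⟩-inclusions of divergence-free elements induces a ℂ-linear isomorphism PV^d ⊕ ⨁_{i=0}^{d−2} PV^i_∂ → ker T / im T. (This computes the cohomology of the fields of minimal BCOV theory with (d−1)-potentials on ℂ^d with respect to t∂.) -/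

import Mathlib

/-!
Setup: the supercommutative algebra `A = ℂ[x_1,…,x_d] ⊗ Λ[ξ_1,…,ξ_d]`
of polynomial polyvector fields on `ℂ^d`, encoded by coefficients: an element
`f : PVA d` assigns to each finite set `S ⊆ Fin d` the polynomial coefficient
of the monomial `ξ_S` (the product of the `ξ_i`, `i ∈ S`, in increasing order).
-/

noncomputable section

namespace BCOV

/-- Polynomial coefficient ring `ℂ[x_1,…,x_d]`. -/
abbrev MPoly (d : ℕ) : Type := MvPolynomial (Fin d) ℂ

/-- The algebra `A` of polynomial polyvector fields on `ℂ^d`. -/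
abbrev PVA (d : ℕ) : Type := Finset (Fin d) → MPoly d

variable {d : ℕ}

/-- Koszul sign arising when multiplying `ξ_T · ξ_U` for disjoint `T`, `U`. -/
def koszulSign (T U : Finset (Fin d)) : ℂ :=
  (-1 : ℂ) ^ (((T ×ˢ U).filter fun p : (Fin d) × (Fin d) => p.2 < p.1).card)

/-- The supercommutative product on `A`. -/
def mul (f g : PVA d) : PVA d := fun S =>
  ∑ T ∈ S.powerset, koszulSign T (S \ T) • (f T * g (S \ T))

/-- The even partial derivative `∂/∂x_i`. -/
def Dx (i : Fin d) (f : PVA d) : PVA d := fun S => MvPolynomial.pderiv i (f S)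

/-- The left odd partial derivative `∂/∂ξ_i`. -/
def Dxi (i : Fin d) (f : PVA d) : PVA d := fun S =>
  if i ∈ S then 0
  else ((-1 : ℂ) ^ ((S.filter fun j => j < i).card)) • f (insert i S)

/-- The divergence operator `∂ = Σ_i ∂_{x_i} ∂_{ξ_i}` (with respect to the
standard holomorphic volume form). -/
def dvg (f : PVA d) : PVA d := ∑ i : Fin d, Dx i (Dxi i f)

/-- `f` lies in `PV^j`: only coefficients of `ξ`-monomials of length `j` occur. -/
def IsHomog (j : ℕ) (f : PVA d) : Prop :=
  ∀ S : Finset (Fin d), S.card ≠ j → f S = 0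

/-- The Schouten–Nijenhuis bracket `[f, g]` of `f ∈ PV^a` with `g`:
`[f,g] = (−1)^{a−1} (∂(fg) − (∂f)g − (−1)^a f (∂g))`. -/
def sn (a : ℕ) (f g : PVA d) : PVA d :=
  ((-1 : ℂ) ^ (a + 1)) •
    (dvg (mul f g) - mul (dvg f) g - ((-1 : ℂ) ^ a) • mul f (dvg g))

/-- The top polyvector field `ξ_1 ⋯ ξ_d`. -/
def xiTop : PVA d := fun S => if S = Finset.univ then 1 else 0

/-- `τ`: the value at `x = 0` of the coefficient of `ξ_1 ⋯ ξ_d`. -/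
def tauA (f : PVA d) : ℂ := MvPolynomial.constantCoeff (f Finset.univ)

/-- `σ`: the constant term. -/
def sigmaA (f : PVA d) : ℂ := MvPolynomial.constantCoeff (f ∅)

lemma Dx_add (i : Fin d) (f g : PVA d) : Dx i (f + g) = Dx i f + Dx i g := by
  funext S; simp [Dx]

lemma Dx_smul (i : Fin d) (c : ℂ) (f : PVA d) : Dx i (c • f) = c • Dx i f := by
  funext S; simp [Dx]

lemma Dxi_add (i : Fin d) (f g : PVA d) : Dxi i (f + g) = Dxi i f + Dxi i g := by
  funext S
  by_cases h : i ∈ S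
  · simp [Dxi, h]
  · simp [Dxi, h, smul_add]

lemma Dxi_smul (i : Fin d) (c : ℂ) (f : PVA d) : Dxi i (c • f) = c • Dxi i f := by
  funext S
  by_cases h : i ∈ S
  · simp [Dxi, h]
  · simp only [Dxi, if_neg h, Pi.smul_apply]
    rw [smul_comm]

lemma dvg_add (f g : PVA d) : dvg (f + g) = dvg f + dvg g := by
  simp [dvg, Dxi_add, Dx_add, Finset.sum_add_distrib]

lemma dvg_smul (c : ℂ) (f : PVA d) : dvg (c • f) = c • dvg f := by
  simp [dvg, Dxi_smul, Dx_smul, Finset.smul_sum]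

/-- The divergence operator as a `ℂ`-linear endomorphism of `A`. -/
def dvgL (d : ℕ) : PVA d →ₗ[ℂ] PVA d where
  toFun := dvg
  map_add' := dvg_add
  map_smul' := dvg_smul

lemma IsHomog.add {j : ℕ} {f g : PVA d} (hf : IsHomog j f) (hg : IsHomog j g) :
    IsHomog j (f + g) := fun S hS => by
  simp only [Pi.add_apply, hf S hS, hg S hS, add_zero]

lemma isHomog_zero {j : ℕ} : IsHomog j (0 : PVA d) := fun _ _ => rfl

lemma IsHomog.smul {j : ℕ} {f : PVA d} (c : ℂ) (hf : IsHomog j f) :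
    IsHomog j (c • f) := fun S hS => by
  simp only [Pi.smul_apply, hf S hS, smul_zero]

/-- The subspace `PV^j ⊆ A` of `j`-polyvector fields. -/
def PVsub (d j : ℕ) : Submodule ℂ (PVA d) where
  carrier := {f | IsHomog j f}
  add_mem' hf hg := hf.add hg
  zero_mem' := isHomog_zero
  smul_mem' c _ hf := hf.smul c

/-- The subspace `PV^j_∂ ⊆ A` of divergence-free `j`-polyvector fields. -/
def PVd (d j : ℕ) : Submodule ℂ (PVA d) := PVsub d j ⊓ LinearMap.ker (dvgL d)

/-- Ambient space containing `M′ = PV^d⟨⋆⟩ ⊕ ⨁_{(i,k) : i+k ≤ d−2} PV^i⟨k⟩`: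
the first factor is the copy `PV^d⟨⋆⟩`, the second the family of copies
`PV^i⟨k⟩`. -/
abbrev F10 (d : ℕ) := PVA d × ((ℕ × ℕ) → PVA d)

/-- The `ℂ`-linear map `T`, zero on `PV^d⟨⋆⟩`, sending `μ ∈ PV^i⟨k⟩` to
`∂μ ∈ PV^{i−1}⟨k+1⟩` (and to `0` when `i = 0`). -/
def T10 (d : ℕ) : F10 d →ₗ[ℂ] F10 d where
  toFun m := (0, fun p => if p.2 = 0 then 0 else dvg (m.2 (p.1 + 1, p.2 - 1)))
  map_add' m n := by
    refine Prod.ext (by simp) ?_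
    funext p
    by_cases h : p.2 = 0 <;> simp [h, dvg_add]
  map_smul' c m := by
    refine Prod.ext (by simp) ?_
    funext p
    by_cases h : p.2 = 0 <;> simp [h, dvg_smul]

/-- The subspace `M′ = PV^d⟨⋆⟩ ⊕ ⨁_{(i,k) : i,k ≥ 0, i+k ≤ d−2} PV^i⟨k⟩`. -/
def M10 (d : ℕ) : Submodule ℂ (F10 d) where
  carrier := {m | IsHomog d m.1 ∧
    ∀ p : ℕ × ℕ, IsHomog p.1 (m.2 p) ∧ (d - 2 < p.1 + p.2 → m.2 p = 0)}
  add_mem' := fun {f g} hf hg => ⟨(hf.1).add hg.1,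
    fun p => ⟨((hf.2 p).1).add (hg.2 p).1,
      fun h => by simp only [Prod.snd_add, Pi.add_apply, (hf.2 p).2 h, (hg.2 p).2 h, add_zero]⟩⟩
  zero_mem' := ⟨isHomog_zero, fun p => ⟨isHomog_zero, fun _ => rfl⟩⟩
  smul_mem' := fun c f hf => ⟨(hf.1).smul c,
    fun p => ⟨((hf.2 p).1).smul c,
      fun h => by simp only [Prod.smul_snd, Pi.smul_apply, (hf.2 p).2 h, smul_zero]⟩⟩

/-- `PV^d ⊕ ⨁_{i=0}^{d−2} PV^i_∂`. -/
abbrev S10 (d : ℕ) := ↥(PVsub d d) × (∀ i : Fin (d - 1), ↥(PVd d (i : ℕ)))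

/-- The map `PV^d ⊕ ⨁_{i=0}^{d−2} PV^i_∂ → M′` given by the identity on
`PV^d⟨⋆⟩` together with the `⟨0⟩`-inclusions of divergence-free elements. -/
def incl10 (d : ℕ) (s : S10 d) : F10 d :=
  ((s.1 : PVA d),
    fun p => if h : p.2 = 0 ∧ p.1 < d - 1 then (s.2 ⟨p.1, h.2⟩ : PVA d) else 0)

/-- The cohomology `ker T / im T` of `(M′, T)`. -/
abbrev Coh10 (d : ℕ) :=
  ↥(M10 d ⊓ LinearMap.ker (T10 d)) ⧸
    (Submodule.comap (M10 d ⊓ LinearMap.ker (T10 d)).subtype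
      (Submodule.map (T10 d) (M10 d)))

/-- The sign `(-1)^{#{j ∈ S : j < i}}` of `∂/∂ξ_i` and of `ξ_i ·` on `ξ_S`. -/
def xiSign (i : Fin d) (S : Finset (Fin d)) : ℂ := (-1 : ℂ) ^ ((S.filter fun j => j < i).card)

lemma xiSign_mul_self (i : Fin d) (S : Finset (Fin d)) : xiSign i S * xiSign i S = 1 := by
  rw [xiSign, ← mul_pow]; simp

lemma xiSign_insert (i : Fin d) {j : Fin d} {S : Finset (Fin d)} (h : j ∉ S) :
    xiSign i (insert j S) = if j < i then -xiSign i S else xiSign i S := by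
  unfold xiSign
  rw [Finset.filter_insert]
  split_ifs
  · rw [Finset.card_insert_of_notMem (by simp [h]), pow_succ]; ring
  · rfl

lemma Dxi_apply (i : Fin d) (f : PVA d) (S : Finset (Fin d)) :
    Dxi i f S = if i ∈ S then 0 else xiSign i S • f (insert i S) := rfl

/-- Left multiplication by `ξ_i`. -/
def wedge (i : Fin d) (f : PVA d) : PVA d := fun S =>
  if i ∈ S then xiSign i S • f (S.erase i) else 0

/-- Multiplication by `x_i`. -/
def xMul (i : Fin d) (f : PVA d) : PVA d := fun S => MvPolynomial.X i * f S

/-- The Koszul-type operator `Σ_i x_i ξ_i`. -/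
def koszul (f : PVA d) : PVA d := ∑ i : Fin d, xMul i (wedge i f)

lemma wedge_add (i : Fin d) (f g : PVA d) : wedge i (f + g) = wedge i f + wedge i g := by
  funext S
  by_cases h : i ∈ S <;> simp [wedge, h]

lemma xMul_add (i : Fin d) (f g : PVA d) : xMul i (f + g) = xMul i f + xMul i g := by
  funext S; simp [xMul, mul_add]

lemma Dx_sum {ι : Type*} (s : Finset ι) (i : Fin d) (F : ι → PVA d) :
    Dx i (∑ j ∈ s, F j) = ∑ j ∈ s, Dx i (F j) :=
  map_sum (AddMonoidHom.mk' (Dx i) (Dx_add i)) F s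

lemma Dxi_sum {ι : Type*} (s : Finset ι) (i : Fin d) (F : ι → PVA d) :
    Dxi i (∑ j ∈ s, F j) = ∑ j ∈ s, Dxi i (F j) :=
  map_sum (AddMonoidHom.mk' (Dxi i) (Dxi_add i)) F s

lemma wedge_sum {ι : Type*} (s : Finset ι) (i : Fin d) (F : ι → PVA d) :
    wedge i (∑ j ∈ s, F j) = ∑ j ∈ s, wedge i (F j) :=
  map_sum (AddMonoidHom.mk' (wedge i) (wedge_add i)) F s

lemma xMul_sum {ι : Type*} (s : Finset ι) (i : Fin d) (F : ι → PVA d) :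
    xMul i (∑ j ∈ s, F j) = ∑ j ∈ s, xMul i (F j) :=
  map_sum (AddMonoidHom.mk' (xMul i) (xMul_add i)) F s

lemma xMul_sub (i : Fin d) (f g : PVA d) : xMul i (f - g) = xMul i f - xMul i g :=
  map_sub (AddMonoidHom.mk' (xMul i) (xMul_add i)) f g

lemma Dx_neg (i : Fin d) (f : PVA d) : Dx i (-f) = -Dx i f :=
  map_neg (AddMonoidHom.mk' (Dx i) (Dx_add i)) f

lemma Dx_Dxi (i j : Fin d) (f : PVA d) : Dx i (Dxi j f) = Dxi j (Dx i f) := by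
  funext S
  by_cases h : j ∈ S <;> simp [Dx, Dxi_apply, h]

lemma Dx_comm (i j : Fin d) (f : PVA d) : Dx i (Dx j f) = Dx j (Dx i f) := by
  funext S
  ext m
  simp only [Dx, MvPolynomial.coeff_pderiv, Finsupp.add_apply, Finsupp.single_apply]
  rw [add_right_comm]
  by_cases h : i = j
  · subst h; rfl
  · simp [h, Ne.symm h]; ring

lemma Dxi_anticomm (i j : Fin d) (f : PVA d) : Dxi i (Dxi j f) = -Dxi j (Dxi i f) := by
  funext S
  simp only [Dxi_apply, Pi.neg_apply]
  by_cases hi : i ∈ S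
  · simp [hi]
  by_cases hj : j ∈ S
  · simp [hj]
  by_cases hij : i = j
  · subst hij; simp
  simp only [hi, hj, hij, Ne.symm hij, if_false, Finset.mem_insert, or_self, smul_smul,
    xiSign_insert _ hi, xiSign_insert _ hj, Finset.insert_comm j i S, ← neg_smul]
  congr 1
  rcases lt_or_gt_of_ne hij with h | h
  · simp [h, h.not_gt]; ring
  · simp [h, h.not_gt]; ring

lemma dvg_dvg (f : PVA d) : dvg (dvg f) = 0 := by
  have key : dvg (dvg f) = -dvg (dvg f) := by
    simp only [dvg, Dx_sum, Dxi_sum, ← Finset.sum_neg_distrib]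
    rw [Finset.sum_comm]
    refine Finset.sum_congr rfl fun i _ => Finset.sum_congr rfl fun j _ => ?_
    rw [← Dx_Dxi i j, Dxi_anticomm j i, ← Dx_Dxi j i, Dx_comm j i, Dx_neg, Dx_neg]
  exact self_eq_neg.mp key

lemma Dx_xMul (i j : Fin d) (f : PVA d) :
    Dx i (xMul j f) = (if i = j then f else 0) + xMul j (Dx i f) := by
  funext S
  by_cases h : i = j
  · subst h; simp [Dx, xMul, add_comm]
  · simp [Dx, xMul, h, MvPolynomial.pderiv_X_of_ne (Ne.symm h)]

lemma Dxi_xMul (i j : Fin d) (f : PVA d) : Dxi i (xMul j f) = xMul j (Dxi i f) := by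
  funext S
  by_cases h : i ∈ S <;> simp [xMul, Dxi_apply, h]

lemma Dx_wedge (i j : Fin d) (f : PVA d) : Dx i (wedge j f) = wedge j (Dx i f) := by
  funext S
  by_cases h : j ∈ S <;> simp [Dx, wedge, h]

lemma Dxi_wedge (i j : Fin d) (f : PVA d) :
    Dxi i (wedge j f) = (if i = j then f else 0) - wedge j (Dxi i f) := by
  funext S
  by_cases hij : i = j
  · subst hij
    by_cases hi : i ∈ S
    · obtain ⟨U, hU, rfl⟩ : ∃ U, i ∉ U ∧ insert i U = S :=
        ⟨S.erase i, Finset.notMem_erase i S, Finset.insert_erase hi⟩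
      simp [Dxi_apply, wedge, hU, smul_smul, xiSign_insert, xiSign_mul_self]
    · simp [Dxi_apply, wedge, hi, smul_smul, xiSign_insert, xiSign_mul_self]
  · by_cases hj : j ∈ S
    · obtain ⟨U, hU, rfl⟩ : ∃ U, j ∉ U ∧ insert j U = S :=
        ⟨S.erase j, Finset.notMem_erase j S, Finset.insert_erase hj⟩
      by_cases hi : i ∈ U
      · simp [Dxi_apply, wedge, hij, hi, hU]
      · have hj' : j ∉ insert i U := by simp [hU, Ne.symm hij]
        simp only [Dxi_apply, wedge, hij, hi, Finset.mem_insert, or_self, if_false, true_or,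
          if_true, smul_smul, Pi.sub_apply, Pi.zero_apply, zero_sub,
          Finset.insert_comm i j U, Finset.erase_insert hj', Finset.erase_insert hU,
          xiSign_insert _ hj', xiSign_insert _ hU, xiSign_insert _ hi, ← neg_smul]
        congr 1
        rcases lt_or_gt_of_ne hij with h | h
        · simp [h, h.not_gt]; ring
        · simp [h, h.not_gt]; ring
    · simp [Dxi_apply, wedge, hij, hj, Ne.symm hij]

lemma dvg_koszul_add (f : PVA d) :
    dvg (koszul f) + koszul (dvg f) =
      ∑ i : Fin d, Dxi i (wedge i f) + ∑ i : Fin d, xMul i (Dx i f) := by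
  have h1 : dvg (koszul f) = ∑ i : Fin d, Dxi i (wedge i f) + ∑ i : Fin d, xMul i (Dx i f)
      - ∑ i : Fin d, ∑ j : Fin d, xMul j (wedge j (Dx i (Dxi i f))) := by
    simp only [dvg, koszul, Dxi_sum, Dx_sum, Dxi_xMul, Dx_xMul, Dx_Dxi, Dx_wedge]
    rw [← Finset.sum_add_distrib, ← Finset.sum_sub_distrib]
    refine Finset.sum_congr rfl fun i _ => ?_
    rw [Finset.sum_add_distrib, add_sub_assoc]
    congr 1
    · simp
    · simp only [Dxi_wedge, xMul_sub, Finset.sum_sub_distrib]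
      congr 1
      rw [Finset.sum_eq_single i]
      · simp
      · intro j _ hj
        funext S; simp [xMul, Ne.symm hj]
      · simp
  have h2 : koszul (dvg f) = ∑ i : Fin d, ∑ j : Fin d, xMul j (wedge j (Dx i (Dxi i f))) := by
    simp only [dvg, koszul, wedge_sum, xMul_sum]
    exact Finset.sum_comm
  rw [h1, h2, sub_add_cancel]

/-- The operator `a + Σ_i x_i ∂_{x_i}` on polynomials. -/
def eulerShift (a : ℂ) (p : MPoly d) : MPoly d :=
  a • p + ∑ i : Fin d, MvPolynomial.X i * MvPolynomial.pderiv i p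

lemma coeff_eulerShift (a : ℂ) (p : MPoly d) (m : Fin d →₀ ℕ) :
    (eulerShift a p).coeff m = (a + ∑ i, (m i : ℂ)) * p.coeff m := by
  have h (i : Fin d) : (MvPolynomial.X i * MvPolynomial.pderiv i p).coeff m =
      (m i : ℂ) * p.coeff m := by
    rw [MvPolynomial.coeff_X_mul']
    by_cases hi : m i = 0
    · simp [hi]
    · have hle : Finsupp.single i 1 ≤ m := by
        rw [Finsupp.single_le_iff]; omega
      have hm : 1 ≤ m i := by omega
      rw [if_pos (Finsupp.mem_support_iff.mpr hi), MvPolynomial.coeff_pderiv,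
        tsub_add_cancel_of_le hle]
      simp [Nat.cast_sub hm, mul_comm]
  simp only [eulerShift, MvPolynomial.coeff_add, MvPolynomial.coeff_smul, MvPolynomial.coeff_sum, h,
    smul_eq_mul, add_mul, Finset.sum_mul]

lemma eulerShift_add (a : ℂ) (p q : MPoly d) :
    eulerShift a (p + q) = eulerShift a p + eulerShift a q := by
  ext m; simp only [coeff_eulerShift, MvPolynomial.coeff_add, mul_add]

lemma natCast_add_sum_ne_zero {a : ℕ} (ha : a ≠ 0) (m : Fin d →₀ ℕ) :
    (a : ℂ) + ∑ i, (m i : ℂ) ≠ 0 := by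
  have : a + ∑ i, m i ≠ 0 := by omega
  exact_mod_cast this

lemma eulerShift_eq_zero {a : ℕ} (ha : a ≠ 0) {p : MPoly d} (h : eulerShift (a : ℂ) p = 0) :
    p = 0 := by
  ext m
  have hm := congrArg (MvPolynomial.coeff m) h
  rw [coeff_eulerShift] at hm
  simpa [natCast_add_sum_ne_zero ha m] using hm

lemma eulerShift_surjective {a : ℕ} (ha : a ≠ 0) :
    Function.Surjective (eulerShift (d := d) (a : ℂ)) := by
  intro p
  induction p using MvPolynomial.induction_on' with
  | monomial m r =>
    refine ⟨MvPolynomial.monomial m (r / (a + ∑ i, (m i : ℂ))), ?_⟩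
    ext n
    rw [coeff_eulerShift, MvPolynomial.coeff_monomial, MvPolynomial.coeff_monomial]
    split_ifs with h
    · subst h
      exact mul_div_cancel₀ _ (natCast_add_sum_ne_zero ha m)
    · simp
  | add p q hp hq =>
    obtain ⟨p', rfl⟩ := hp
    obtain ⟨q', rfl⟩ := hq
    exact ⟨p' + q', eulerShift_add _ _ _⟩

lemma dvg_koszul_add_apply (f : PVA d) (S : Finset (Fin d)) :
    (dvg (koszul f) + koszul (dvg f)) S = eulerShift (Sᶜ.card : ℂ) (f S) := by
  have h (i : Fin d) : Dxi i (wedge i f) S = if i ∈ Sᶜ then f S else 0 := by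
    by_cases hi : i ∈ S
    · simp [Dxi_apply, hi]
    · simp [Dxi_apply, wedge, hi, smul_smul, xiSign_insert, xiSign_mul_self]
  rw [dvg_koszul_add]
  simp only [Pi.add_apply, Finset.sum_apply, h, eulerShift, Finset.sum_ite_mem, Finset.univ_inter,
    Finset.sum_const, xMul, Dx, Nat.cast_smul_eq_nsmul]

lemma dvg_apply (f : PVA d) (S : Finset (Fin d)) :
    dvg f S = ∑ i : Fin d, MvPolynomial.pderiv i (Dxi i f S) := by
  simp [dvg, Dx, Finset.sum_apply]

lemma IsHomog.dvg {j : ℕ} {f : PVA d} (hf : IsHomog (j + 1) f) : IsHomog j (dvg f) := by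
  intro S hS
  rw [dvg_apply]
  refine Finset.sum_eq_zero fun i _ => ?_
  rw [Dxi_apply]
  split_ifs with hi
  · simp
  · rw [hf _ (by rw [Finset.card_insert_of_notMem hi]; omega)]; simp

lemma IsHomog.dvg_eq_zero {f : PVA d} (hf : IsHomog 0 f) : BCOV.dvg f = 0 := by
  funext S
  rw [dvg_apply]
  refine Finset.sum_eq_zero fun i _ => ?_
  rw [Dxi_apply, hf _ (by simp)]; simp

lemma IsHomog.koszul {j : ℕ} {f : PVA d} (hf : IsHomog j f) : IsHomog (j + 1) (koszul f) := by
  intro S hS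
  simp only [BCOV.koszul, Finset.sum_apply]
  refine Finset.sum_eq_zero fun i _ => ?_
  by_cases hi : i ∈ S
  · have := Finset.card_erase_add_one hi
    simp [xMul, wedge, hf (S.erase i) (by omega)]
  · simp [xMul, wedge, hi]

/-- Poincaré lemma: a divergence-free polynomial `j`-polyvector field with `j < d` is the
divergence of a `(j + 1)`-polyvector field. -/
lemma exists_dvg_eq {j : ℕ} (hj : j < d) {f : PVA d} (hf : IsHomog j f) (h : dvg f = 0) :
    ∃ g : PVA d, IsHomog (j + 1) g ∧ dvg g = f := by
  have hcard {S : Finset (Fin d)} (hS : S ≠ Finset.univ) : Sᶜ.card ≠ 0 := by simpa using hS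
  have hex (S : Finset (Fin d)) :
      ∃ p : MPoly d, eulerShift (Sᶜ.card : ℂ) p = f S ∧ (S.card ≠ j → p = 0) := by
    by_cases hS : S.card = j
    · have hu : S ≠ Finset.univ := by
        rintro rfl
        simp at hS
        omega
      obtain ⟨p, hp⟩ := eulerShift_surjective (hcard hu) (f S)
      exact ⟨p, hp, fun h => absurd hS h⟩
    · exact ⟨0, by simp [eulerShift, hf S hS], fun _ => rfl⟩
  choose g hg hg0 using hex
  have hW : dvg (koszul g) + koszul (dvg g) = f := by
    funext S
    rw [dvg_koszul_add_apply, hg]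
  have hkoszul : koszul (0 : PVA d) = 0 := by
    funext S
    simp [koszul, xMul, wedge, Finset.sum_apply]
  have hdvg : dvg g = 0 := by
    funext S
    by_cases hu : S = Finset.univ
    · simp [hu, dvg_apply, Dxi_apply]
    · refine eulerShift_eq_zero (hcard hu) ?_
      have h2 := congrArg dvg hW
      rw [dvg_add, dvg_dvg, zero_add, h] at h2
      rw [← dvg_koszul_add_apply, dvg_dvg, hkoszul, add_zero, h2]
      rfl
  refine ⟨koszul g, IsHomog.koszul hg0, ?_⟩
  rwa [hdvg, hkoszul, add_zero] at hW

lemma T10_mem_M10 {m : F10 d} (hm : m ∈ M10 d) : T10 d m ∈ M10 d := by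
  refine ⟨isHomog_zero, fun p => ?_⟩
  by_cases hp : p.2 = 0
  · simp [T10, hp, isHomog_zero]
  · have hm' := hm.2 (p.1 + 1, p.2 - 1)
    simp only [T10, LinearMap.coe_mk, AddHom.coe_mk, hp, if_false]
    refine ⟨hm'.1.dvg, fun h => ?_⟩
    rw [hm'.2 (by dsimp only; omega)]
    exact map_zero (dvgL d)

lemma T10_comp_T10 : (T10 d).comp (T10 d) = 0 := by
  refine LinearMap.ext fun m => Prod.ext rfl (funext fun p => ?_)
  have h0 : dvg (0 : PVA d) = 0 := map_zero (dvgL d)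
  simp only [T10, LinearMap.comp_apply, LinearMap.coe_mk, AddHom.coe_mk, LinearMap.zero_apply]
  split_ifs <;> simp [h0, dvg_dvg]

lemma mem_ker_T10 {m : F10 d} :
    m ∈ LinearMap.ker (T10 d) ↔ ∀ i k, dvg (m.2 (i + 1, k)) = 0 := by
  rw [LinearMap.mem_ker]
  constructor
  · intro h i k
    simpa [T10] using congrFun (congrArg Prod.snd h) (i, k + 1)
  · intro h
    refine Prod.ext rfl (funext fun p => ?_)
    simp [T10, h]

lemma incl10_mem (s : S10 d) : incl10 d s ∈ M10 d ⊓ LinearMap.ker (T10 d) := by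
  refine ⟨⟨s.1.2, fun p => ?_⟩, mem_ker_T10.mpr fun i k => ?_⟩
  · simp only [incl10]
    split_ifs with h
    · exact ⟨(s.2 ⟨p.1, h.2⟩).2.1, fun h' => by omega⟩
    · exact ⟨isHomog_zero, fun _ => rfl⟩
  · simp only [incl10]
    split_ifs with h
    · exact (s.2 ⟨i + 1, h.2⟩).2.2
    · exact map_zero (dvgL d)

/-- The map `incl10` as a linear map into `ker T`. -/
def incl10L (d : ℕ) : S10 d →ₗ[ℂ] ↥(M10 d ⊓ LinearMap.ker (T10 d)) where
  toFun s := ⟨incl10 d s, incl10_mem s⟩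
  map_add' s t := by
    refine Subtype.ext (Prod.ext rfl (funext fun p => ?_))
    by_cases h : p.2 = 0 ∧ p.1 < d - 1 <;> simp [incl10, h]
  map_smul' c s := by
    refine Subtype.ext (Prod.ext rfl (funext fun p => ?_))
    by_cases h : p.2 = 0 ∧ p.1 < d - 1 <;> simp [incl10, h]

lemma eq_zero_of_T10_eq_incl10 {s : S10 d} {m : F10 d} (h : T10 d m = incl10 d s) : s = 0 := by
  refine Prod.ext (Subtype.ext (congrArg Prod.fst h).symm) (funext fun i => Subtype.ext ?_)
  simpa [T10, incl10] using (congrFun (congrArg Prod.snd h) ((i : ℕ), 0)).symm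

lemma exists_T10_add_incl10 (hd : 2 ≤ d) {x : F10 d} (hx : x ∈ M10 d ⊓ LinearMap.ker (T10 d)) :
    ∃ n ∈ M10 d, ∃ s : S10 d, T10 d n + incl10 d s = x := by
  obtain ⟨hM, hT⟩ := hx
  replace hT := mem_ker_T10.mp hT
  have hdvg (p : ℕ × ℕ) : dvg (x.2 p) = 0 := by
    obtain ⟨i, k⟩ := p
    cases i with
    | zero => exact (hM.2 (0, k)).1.dvg_eq_zero
    | succ i => exact hT i k
  have hex (p : ℕ × ℕ) : ∃ g : PVA d, IsHomog (p.1 + 1) g ∧ dvg g = x.2 p ∧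
      (d - 2 < p.1 + p.2 → g = 0) := by
    by_cases hp : d - 2 < p.1 + p.2
    · refine ⟨0, isHomog_zero, ?_, fun _ => rfl⟩
      rw [(hM.2 p).2 hp]
      exact map_zero (dvgL d)
    · obtain ⟨g, hg, hgx⟩ := exists_dvg_eq (by omega) (hM.2 p).1 (hdvg p)
      exact ⟨g, hg, hgx, fun h => absurd h hp⟩
  choose g hg hgx hg0 using hex
  refine ⟨(0, fun q => if q.1 = 0 then 0 else g (q.1 - 1, q.2 + 1)),
    ⟨isHomog_zero, fun q => ?_⟩,
    (⟨x.1, hM.1⟩, fun i => ⟨x.2 (i, 0), (hM.2 (i, 0)).1, hdvg _⟩), ?_⟩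
  · by_cases hq : q.1 = 0
    · simp [hq, isHomog_zero]
    · simp only [hq, if_false]
      refine ⟨?_, fun h => hg0 _ (by dsimp only; omega)⟩
      have := hg (q.1 - 1, q.2 + 1)
      rwa [Nat.sub_add_cancel (Nat.pos_of_ne_zero hq)] at this
  · refine Prod.ext (by simp [T10, incl10]) (funext fun p => ?_)
    obtain ⟨i, k⟩ := p
    rcases Nat.eq_zero_or_pos k with rfl | hk
    · by_cases hi : i < d - 1
      · simp [T10, incl10, hi]
      · simpa [T10, incl10, hi] using ((hM.2 (i, 0)).2 (by dsimp only; omega)).symm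
    · have hk' : k ≠ 0 := hk.ne'
      simp [T10, incl10, hk', Nat.sub_add_cancel hk, hgx]

/-- With `M′ = PV^d⟨⋆⟩ ⊕ ⨁_{(i,k) : i,k ≥ 0, i+k ≤ d−2}
PV^i⟨k⟩` and `T : M′ → M′` zero on `PV^d⟨⋆⟩` and sending `μ ∈ PV^i⟨k⟩` to
`∂μ ∈ PV^{i−1}⟨k+1⟩` (zero when `i = 0`): `T∘T = 0` and the map given by the
identity on `PV^d⟨⋆⟩` together with the `⟨0⟩`-inclusions of divergence-free
elements induces a `ℂ`-linear isomorphism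
`PV^d ⊕ ⨁_{i=0}^{d−2} PV^i_∂ → ker T / im T`.  (This computes the cohomology
of the fields of minimal BCOV theory with `(d−1)`-potentials on `ℂ^d` with
respect to `t∂`.) -/
theorem potential_bcov_cohomology (d : ℕ) (hd : 2 ≤ d) :
    (∀ m ∈ M10 d, T10 d m ∈ M10 d) ∧
    (T10 d).comp (T10 d) = 0 ∧
    ∃ φ : S10 d →ₗ[ℂ] Coh10 d, Function.Bijective φ ∧
      ∀ s : S10 d, ∃ h : incl10 d s ∈ M10 d ⊓ LinearMap.ker (T10 d),
        φ s = Submodule.Quotient.mk ⟨incl10 d s, h⟩ := by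
  refine ⟨fun m hm => T10_mem_M10 hm, T10_comp_T10,
    (Submodule.mkQ _).comp (incl10L d), ⟨?_, ?_⟩, fun s => ⟨incl10_mem s, rfl⟩⟩
  · rw [← LinearMap.ker_eq_bot, LinearMap.ker_eq_bot']
    intro s hs
    obtain ⟨m, -, hm⟩ := (Submodule.Quotient.mk_eq_zero _).mp hs
    exact eq_zero_of_T10_eq_incl10 hm
  · intro y
    obtain ⟨⟨x, hx⟩, rfl⟩ := Submodule.mkQ_surjective _ y
    obtain ⟨n, hn, s, h⟩ := exists_T10_add_incl10 hd hx
    refine ⟨s, ((Submodule.Quotient.eq _).mpr ⟨-n, neg_mem hn, ?_⟩)⟩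
    rw [map_neg, ← sub_eq_zero]
    simp [incl10L, ← h]

end BCOV
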